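/- Let γ ∈ [0,1]. The function ā = a*μ is smooth on ℝ³, and for every multi-index β ∈ ℕ³ there exists a constant C_β > 0 such that for all v ∈ ℝ³ and all i,j ∈ {1,2,3}, |∂^β ā_{ij}(v)| ≤ C_β ⟨v⟩^{γ+2−|β|}, where ⟨v⟩ := (1+|v|²)^{1/2}. -/

import Mathlib

open MeasureTheory Real Filter

noncomputable section

abbrev E3 : Type := EuclideanSpace ℝ (Fin 3)

/-- The standard Gaussian on ℝ³. -/
def gauss (v : E3) : ℝ :=
  (2 * π) ^ (-(3 : ℝ) / 2) * Real.exp (-‖v‖ ^ 2 / 2)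

/-- `J_α(v) = ∫ |v - w|^α μ(w) dw`. -/
def Jfun (α : ℝ) (v : E3) : ℝ :=
  ∫ w : E3, ‖v - w‖ ^ α * gauss w

/-- The matrix `a_{ij}(z) = |z|^{γ+2} (δ_{ij} - z_i z_j / |z|²)` (equal to `0` at `z = 0`). -/
def amat (γ : ℝ) (z : E3) (i j : Fin 3) : ℝ :=
  ‖z‖ ^ (γ + 2) * ((if i = j then (1 : ℝ) else 0) - z i * z j / ‖z‖ ^ 2)

/-- The entrywise convolution `ā = a * μ`. -/
def abar (γ : ℝ) (v : E3) (i j : Fin 3) : ℝ :=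
  ∫ w : E3, amat γ (v - w) i j * gauss w

/-- The eigenvalue `ℓ₁(v)` of `ā(v)` in the direction `v`. -/
def ell1 (γ : ℝ) (v : E3) : ℝ :=
  ∫ w : E3, (1 - (∑ i, (v i / ‖v‖) * (w i / ‖w‖)) ^ 2) * ‖w‖ ^ (γ + 2) * gauss (v - w)

/-- Squared norm of the cross product of two vectors of ℝ³. -/
def crossSq (u w : Fin 3 → ℝ) : ℝ :=
  (u 1 * w 2 - u 2 * w 1) ^ 2 + (u 2 * w 0 - u 0 * w 2) ^ 2 + (u 0 * w 1 - u 1 * w 0) ^ 2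

/-- The eigenvalue `ℓ₂(v)` of `ā(v)` on `v^⊥`. -/
def ell2 (γ : ℝ) (v : E3) : ℝ :=
  ∫ w : E3, (1 - (1 / 2) * crossSq (fun i => v i / ‖v‖) (fun i => w i / ‖w‖)) *
    ‖w‖ ^ (γ + 2) * gauss (v - w)

/-- The partial derivative `∂_i f` in the `i`-th coordinate direction. -/
def pd (i : Fin 3) (f : E3 → ℝ) : E3 → ℝ :=
  fun v => fderiv ℝ f v (EuclideanSpace.single i 1)

/-- The multi-index derivative `∂^β f` for `β ∈ ℕ³`. -/
def multiDeriv (β : Fin 3 → ℕ) (f : E3 → ℝ) : E3 → ℝ :=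
  (pd 0)^[β 0] ((pd 1)^[β 1] ((pd 2)^[β 2] f))

/-- The weight `⟨v⟩ = (1 + |v|²)^{1/2}`. -/
def jap (v : E3) : ℝ := Real.sqrt (1 + ‖v‖ ^ 2)

/-! ### Iterated partial derivatives and symbol classes -/

/-- Iterated partial derivatives along a list of directions. -/
def pdl (l : List (Fin 3)) (f : E3 → ℝ) : E3 → ℝ :=
  l.foldl (fun f i => pd i f) f

/-- Symbol class of order `s`. -/
def SymCl (s : ℝ) (f : E3 → ℝ) : Prop :=
  ContDiff ℝ (⊤ : ℕ∞) f ∧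
    ∀ l : List (Fin 3), ∃ C : ℝ, ∀ v, |pdl l f v| ≤ C * jap v ^ (s - (l.length : ℝ))

lemma one_le_jap (v : E3) : 1 ≤ jap v := by
  unfold jap
  rw [Real.one_le_sqrt]
  nlinarith [sq_nonneg ‖v‖]

lemma jap_pos (v : E3) : 0 < jap v := lt_of_lt_of_le one_pos (one_le_jap v)

lemma jap_sq (v : E3) : jap v ^ 2 = 1 + ‖v‖ ^ 2 := by
  unfold jap
  rw [Real.sq_sqrt]; positivity

lemma norm_le_jap (v : E3) : ‖v‖ ≤ jap v := by
  have := jap_sq v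
  have := jap_pos v
  nlinarith [norm_nonneg v]

lemma jap_le (v : E3) : jap v ≤ 1 + ‖v‖ := by
  have := jap_sq v
  have := jap_pos v
  nlinarith [norm_nonneg v]

lemma jap_neg (v : E3) : jap (-v) = jap v := by simp [jap]

lemma continuous_jap : Continuous jap := by
  unfold jap; fun_prop

lemma continuous_jap_rpow (s : ℝ) : Continuous (fun v => jap v ^ s) :=
  continuous_jap.rpow_const (fun v => Or.inl (jap_pos v).ne')

lemma jap_sub_le (v w : E3) : jap (v - w) ≤ 2 * (jap v * jap w) := by
  have h1 := norm_sub_le v w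
  have h2 := norm_le_jap v
  have h3 := norm_le_jap w
  have h4 := one_le_jap v
  have h5 := one_le_jap w
  have h0 := jap_sq (v - w)
  have h6 := jap_sq v
  have h7 := jap_sq w
  have h8 : ‖v - w‖ ^ 2 ≤ (‖v‖ + ‖w‖) ^ 2 := by gcongr
  have h9 : jap (v - w) ^ 2 ≤ (2 * (jap v * jap w)) ^ 2 := by
    have : (2 * (jap v * jap w)) ^ 2 = 4 * ((1 + ‖v‖ ^ 2) * (1 + ‖w‖ ^ 2)) := by
      rw [← h6, ← h7]; ring
    rw [this, h0]
    nlinarith [sq_nonneg (‖v‖ - ‖w‖), sq_nonneg (‖v‖ * ‖w‖), sq_nonneg ‖v‖, sq_nonneg ‖w‖]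
  exact (sq_le_sq₀ (jap_pos _).le (by have := jap_pos v; have := jap_pos w; positivity)).1 h9

lemma peetre (s : ℝ) (v w : E3) :
    jap (v - w) ^ s ≤ 2 ^ |s| * jap v ^ s * jap w ^ |s| := by
  have hv := jap_pos v
  have hw := jap_pos w
  have hvw := jap_pos (v - w)
  rcases le_total 0 s with hs | hs
  · rw [abs_of_nonneg hs]
    calc jap (v - w) ^ s ≤ (2 * (jap v * jap w)) ^ s :=
          Real.rpow_le_rpow hvw.le (jap_sub_le v w) hs
      _ = _ := by
          rw [Real.mul_rpow (by norm_num) (by positivity), Real.mul_rpow hv.le hw.le]; ring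
  · rw [abs_of_nonpos hs]
    have h : jap v ≤ 2 * (jap (v - w) * jap w) := by
      have := jap_sub_le (v - w) (-w)
      rw [jap_neg] at this
      simpa using this
    have h2 : jap v ^ (-s) ≤ (2 * (jap (v - w) * jap w)) ^ (-s) :=
      Real.rpow_le_rpow hv.le h (by linarith)
    rw [Real.mul_rpow (by norm_num) (by positivity), Real.mul_rpow hvw.le hw.le] at h2
    have e1 : jap v ^ s * jap v ^ (-s) = 1 := by
      rw [← Real.rpow_add hv]; simp
    have e2 : jap (v - w) ^ s * jap (v - w) ^ (-s) = 1 := by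
      rw [← Real.rpow_add hvw]; simp
    calc jap (v - w) ^ s = jap (v - w) ^ s * jap v ^ s * jap v ^ (-s) := by
          rw [mul_assoc, e1, mul_one]
      _ ≤ jap (v - w) ^ s * jap v ^ s *
            (2 ^ (-s) * (jap (v - w) ^ (-s) * jap w ^ (-s))) := by gcongr
      _ = (jap (v - w) ^ s * jap (v - w) ^ (-s)) * (2 ^ (-s) * jap v ^ s * jap w ^ (-s)) := by ring
      _ = _ := by rw [e2, one_mul]

lemma pd_contDiff {f : E3 → ℝ} (hf : ContDiff ℝ (⊤ : ℕ∞) f) (i : Fin 3) :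
    ContDiff ℝ (⊤ : ℕ∞) (pd i f) := by
  unfold pd
  exact (hf.fderiv_right (m := (⊤ : ℕ∞)) (by simp)).clm_apply contDiff_const

lemma pdl_contDiff {f : E3 → ℝ} (hf : ContDiff ℝ (⊤ : ℕ∞) f) (l : List (Fin 3)) :
    ContDiff ℝ (⊤ : ℕ∞) (pdl l f) := by
  induction l generalizing f with
  | nil => exact hf
  | cons i l ih => exact ih (pd_contDiff hf i)

lemma SymCl.pd {s : ℝ} {f : E3 → ℝ} (hf : SymCl s f) (i : Fin 3) : SymCl (s - 1) (pd i f) := by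
  refine ⟨pd_contDiff hf.1 i, fun l => ?_⟩
  obtain ⟨C, hC⟩ := hf.2 (i :: l)
  refine ⟨C, fun v => ?_⟩
  have := hC v
  have e : s - ((i :: l).length : ℝ) = s - 1 - (l.length : ℝ) := by
    push_cast [List.length_cons]; ring
  rw [e] at this
  exact this

lemma SymCl.bound {s : ℝ} {f : E3 → ℝ} (hf : SymCl s f) : ∃ C : ℝ, ∀ v, |f v| ≤ C * jap v ^ s := by
  simpa [pdl] using hf.2 []

lemma clm_eq_sum (T : E3 →L[ℝ] ℝ) :
    T = ∑ i, T (EuclideanSpace.single i 1) • (EuclideanSpace.proj i : E3 →L[ℝ] ℝ) := by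
  ext v
  conv_lhs => rw [← (EuclideanSpace.basisFun (Fin 3) ℝ).sum_repr v]
  simp [mul_comm]

lemma clm_norm_le (T : E3 →L[ℝ] ℝ) : ‖T‖ ≤ ∑ i, |T (EuclideanSpace.single i 1)| := by
  refine T.opNorm_le_bound (Finset.sum_nonneg fun i _ => abs_nonneg _) fun v => ?_
  conv_lhs => rw [clm_eq_sum T]
  have e : (∑ i, T (EuclideanSpace.single i 1) • (EuclideanSpace.proj i : E3 →L[ℝ] ℝ)) v =
      ∑ i, T (EuclideanSpace.single i 1) * v i := by simp
  rw [e, Finset.sum_mul]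
  refine (norm_sum_le _ _).trans (Finset.sum_le_sum fun i _ => ?_)
  rw [norm_mul, Real.norm_eq_abs]
  gcongr
  exact PiLp.norm_apply_le v i

/-- Coinduction for smoothness. -/
lemma contDiff_of_coind (P : ℝ → (E3 → ℝ) → Prop)
    (h1 : ∀ s f, P s f → Differentiable ℝ f) (h2 : ∀ s f, P s f → ∀ i, P (s - 1) (pd i f))
    {s : ℝ} {f : E3 → ℝ} (hf : P s f) : ContDiff ℝ (⊤ : ℕ∞) f := by
  rw [contDiff_infty]
  intro n
  induction n generalizing s f with
  | zero => exact contDiff_zero.2 (h1 s f hf).continuous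
  | succ n ih =>
    push_cast
    rw [contDiff_succ_iff_fderiv]
    refine ⟨h1 s f hf, by simp, ?_⟩
    have : fderiv ℝ f = fun v => ∑ i, pd i f v • (EuclideanSpace.proj i : E3 →L[ℝ] ℝ) := by
      funext v
      exact clm_eq_sum _
    rw [this]
    exact ContDiff.sum fun i _ => (ih (h2 s f hf i)).smul contDiff_const

lemma sym_of_coind (P : ℝ → (E3 → ℝ) → Prop)
    (h1 : ∀ s f, P s f → Differentiable ℝ f) (h2 : ∀ s f, P s f → ∀ i, P (s - 1) (pd i f))
    (h3 : ∀ s f, P s f → ∃ C : ℝ, ∀ v, |f v| ≤ C * jap v ^ s)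
    {s : ℝ} {f : E3 → ℝ} (hf : P s f) : SymCl s f := by
  refine ⟨contDiff_of_coind P h1 h2 hf, fun l => ?_⟩
  induction l generalizing s f with
  | nil => simpa [pdl] using h3 s f hf
  | cons i l ih =>
    obtain ⟨C, hC⟩ := ih (h2 s f hf i)
    refine ⟨C, fun v => ?_⟩
    have := hC v
    have e : s - ((i :: l).length : ℝ) = s - 1 - (l.length : ℝ) := by
      push_cast [List.length_cons]; ring
    rw [e]
    exact this

lemma pd_add {f g : E3 → ℝ} (hf : Differentiable ℝ f) (hg : Differentiable ℝ g) (i : Fin 3) :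
    pd i (fun v => f v + g v) = fun v => pd i f v + pd i g v := by
  funext v
  unfold pd
  rw [fderiv_fun_add (hf v) (hg v)]; rfl

lemma SymCl.differentiable {s : ℝ} {f : E3 → ℝ} (hf : SymCl s f) : Differentiable ℝ f :=
  hf.1.differentiable (by simp)

lemma SymCl.add {s : ℝ} {f g : E3 → ℝ} (hf : SymCl s f) (hg : SymCl s g) :
    SymCl s (fun v => f v + g v) := by
  refine sym_of_coind (fun s h => ∃ f g, SymCl s f ∧ SymCl s g ∧ h = fun v => f v + g v)
    ?_ ?_ ?_ ⟨f, g, hf, hg, rfl⟩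
  · rintro s _ ⟨f, g, hf, hg, rfl⟩
    exact hf.differentiable.add hg.differentiable
  · rintro s _ ⟨f, g, hf, hg, rfl⟩ i
    exact ⟨_, _, hf.pd i, hg.pd i, pd_add hf.differentiable hg.differentiable i⟩
  · rintro s _ ⟨f, g, hf, hg, rfl⟩
    obtain ⟨C, hC⟩ := hf.bound
    obtain ⟨D, hD⟩ := hg.bound
    refine ⟨C + D, fun v => (abs_add_le _ _).trans ?_⟩
    rw [add_mul]
    exact add_le_add (hC v) (hD v)

/-! ### Convolution -/

def cv (f g : E3 → ℝ) (v : E3) : ℝ := ∫ w, f (v - w) * g w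

lemma bound_nonneg {f : E3 → ℝ} {C s : ℝ} (h : ∀ v, |f v| ≤ C * jap v ^ s) : 0 ≤ C := by
  have := (abs_nonneg _).trans (h 0)
  have h2 : jap 0 ^ s = 1 := by simp [jap]
  rw [h2] at this; linarith

lemma cv_integrable {s : ℝ} {f g : E3 → ℝ} (hfc : Continuous f)
    {C : ℝ} (hC : ∀ v, |f v| ≤ C * jap v ^ s) (hgm : AEStronglyMeasurable g volume)
    (hg : ∀ r : ℝ, Integrable (fun w => jap w ^ r * |g w|)) (v : E3) :
    Integrable (fun w => f (v - w) * g w) := by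
  have hC0 := bound_nonneg hC
  refine Integrable.mono' ((hg |s|).const_mul (C * 2 ^ |s| * jap v ^ s)) ?_ ?_
  · exact (hfc.comp (by fun_prop)).aestronglyMeasurable.mul hgm
  · refine Eventually.of_forall fun w => ?_
    rw [norm_mul, Real.norm_eq_abs, Real.norm_eq_abs]
    calc |f (v - w)| * |g w| ≤ (C * jap (v - w) ^ s) * |g w| := by gcongr; exact hC _
      _ ≤ (C * (2 ^ |s| * jap v ^ s * jap w ^ |s|)) * |g w| := by gcongr; exact peetre s v w
      _ = _ := by ring

lemma cv_bound {s : ℝ} {f g : E3 → ℝ} {C : ℝ} (hC : ∀ v, |f v| ≤ C * jap v ^ s)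
    (hg : ∀ r : ℝ, Integrable (fun w => jap w ^ r * |g w|)) :
    ∃ D : ℝ, ∀ v, |cv f g v| ≤ D * jap v ^ s := by
  have hC0 := bound_nonneg hC
  refine ⟨C * 2 ^ |s| * ∫ w, jap w ^ |s| * |g w|, fun v => ?_⟩
  have : ‖cv f g v‖ ≤ ∫ w, C * 2 ^ |s| * jap v ^ s * (jap w ^ |s| * |g w|) := by
    refine norm_integral_le_of_norm_le ((hg |s|).const_mul (C * 2 ^ |s| * jap v ^ s)) ?_
    refine Eventually.of_forall fun w => ?_
    rw [norm_mul, Real.norm_eq_abs, Real.norm_eq_abs]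
    calc |f (v - w)| * |g w| ≤ (C * jap (v - w) ^ s) * |g w| := by gcongr; exact hC _
      _ ≤ (C * (2 ^ |s| * jap v ^ s * jap w ^ |s|)) * |g w| := by gcongr; exact peetre s v w
      _ = _ := by ring
  rw [integral_const_mul, Real.norm_eq_abs] at this
  refine this.trans (le_of_eq (by ring))

lemma SymCl.fderiv_bound {s : ℝ} {f : E3 → ℝ} (hf : SymCl s f) :
    ∃ C : ℝ, 0 ≤ C ∧ ∀ v, ‖fderiv ℝ f v‖ ≤ C * jap v ^ (s - 1) := by
  choose C hC using fun i => (hf.pd i).bound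
  refine ⟨∑ i, C i, Finset.sum_nonneg fun i _ => bound_nonneg (hC i), fun v => ?_⟩
  refine (clm_norm_le _).trans ?_
  rw [Finset.sum_mul]
  exact Finset.sum_le_sum fun i _ => hC i v

lemma cv_hasFDerivAt {s : ℝ} {f g : E3 → ℝ} (hf : SymCl s f)
    (hgm : AEStronglyMeasurable g volume)
    (hg : ∀ r : ℝ, Integrable (fun w => jap w ^ r * |g w|)) (v : E3) :
    Integrable (fun w => g w • fderiv ℝ f (v - w)) ∧
    HasFDerivAt (cv f g) (∫ w, g w • fderiv ℝ f (v - w)) v := by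
  obtain ⟨C0, hC0⟩ := hf.bound
  obtain ⟨C, hC, hCb⟩ := hf.fderiv_bound
  have hfd : Continuous (fderiv ℝ f) := hf.1.continuous_fderiv (by simp)
  have hmeas : AEStronglyMeasurable (fun w => g w • fderiv ℝ f (v - w)) volume :=
    hgm.smul (hfd.comp (by fun_prop : Continuous fun w => v - w)).aestronglyMeasurable
  set r := s - 1
  set K : ℝ := C * 2 ^ |r| * (2 ^ |r| * jap v ^ r * 2 ^ |r|)
  have hbnd : ∀ w, ∀ x ∈ Metric.ball v 1,
      ‖g w • fderiv ℝ f (x - w)‖ ≤ K * (jap w ^ |r| * |g w|) := by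
    intro w x hx
    rw [norm_smul, Real.norm_eq_abs]
    have hx1 : jap x ^ r ≤ 2 ^ |r| * jap v ^ r * 2 ^ |r| := by
      have h1 := peetre r v (v - x)
      rw [sub_sub_cancel] at h1
      have h2 : jap (v - x) ^ |r| ≤ 2 ^ |r| := by
        refine Real.rpow_le_rpow (jap_pos _).le ?_ (abs_nonneg _)
        refine (jap_le _).trans ?_
        rw [Metric.mem_ball, dist_comm, dist_eq_norm] at hx
        linarith
      refine h1.trans ?_
      have := jap_pos v
      gcongr
    calc |g w| * ‖fderiv ℝ f (x - w)‖ ≤ |g w| * (C * jap (x - w) ^ r) := by gcongr; exact hCb _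
      _ ≤ |g w| * (C * (2 ^ |r| * jap x ^ r * jap w ^ |r|)) := by gcongr; exact peetre r x w
      _ ≤ |g w| * (C * (2 ^ |r| * (2 ^ |r| * jap v ^ r * 2 ^ |r|) * jap w ^ |r|)) := by
          have := jap_pos w
          gcongr
      _ = _ := by simp only [K]; ring
  have hKint := (hg |r|).const_mul K
  refine ⟨hKint.mono' hmeas (Eventually.of_forall fun w =>
    hbnd w v (Metric.mem_ball_self one_pos)), ?_⟩
  refine hasFDerivAt_integral_of_dominated_of_fderiv_le (Metric.ball_mem_nhds v one_pos)
    (F := fun v w => f (v - w) * g w) (F' := fun v w => g w • fderiv ℝ f (v - w)) ?_ ?_ hmeas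
    (Eventually.of_forall hbnd) hKint ?_
  · exact Eventually.of_forall fun x => (cv_integrable hf.1.continuous hC0 hgm hg x).1
  · exact cv_integrable hf.1.continuous hC0 hgm hg v
  · refine Eventually.of_forall fun w x _ => ?_
    have h1 : HasFDerivAt (fun x => f (x - w)) (fderiv ℝ f (x - w)) x := by
      have := (hf.differentiable (x - w)).hasFDerivAt.comp x ((hasFDerivAt_id x).sub_const w)
      refine HasFDerivAt.congr_fderiv this ?_
      simp
    exact h1.mul_const (g w)

lemma sym_cv {s : ℝ} {f g : E3 → ℝ} (hf : SymCl s f)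
    (hgm : AEStronglyMeasurable g volume)
    (hg : ∀ r : ℝ, Integrable (fun w => jap w ^ r * |g w|)) : SymCl s (cv f g) := by
  refine sym_of_coind (fun s h => ∃ f, SymCl s f ∧ h = cv f g) ?_ ?_ ?_ ⟨f, hf, rfl⟩
  · rintro s _ ⟨f, hf, rfl⟩ v
    exact (cv_hasFDerivAt hf hgm hg v).2.differentiableAt
  · rintro s _ ⟨f, hf, rfl⟩ i
    refine ⟨_, hf.pd i, ?_⟩
    funext v
    obtain ⟨h1, h2⟩ := cv_hasFDerivAt hf hgm hg v
    unfold pd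
    rw [h2.fderiv, ContinuousLinearMap.integral_apply h1]
    unfold cv
    refine integral_congr_ae (Eventually.of_forall fun w => ?_)
    simp [mul_comm]
  · rintro s _ ⟨f, hf, rfl⟩
    obtain ⟨C, hC⟩ := hf.bound
    exact cv_bound hC hg

/-! ### The Gaussian -/

/-- Polynomials times the Gaussian. -/
inductive PG : (E3 → ℝ) → Prop
  | base : PG gauss
  | coord (i : Fin 3) (f : E3 → ℝ) : PG f → PG (fun v => v i * f v)
  | add (f g : E3 → ℝ) : PG f → PG g → PG (fun v => f v + g v)
  | smul (c : ℝ) (f : E3 → ℝ) : PG f → PG (fun v => c * f v)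

lemma gauss_hasFDerivAt (v : E3) : HasFDerivAt gauss (-(gauss v) • innerSL ℝ v) v := by
  unfold gauss
  have h1 : HasFDerivAt (fun v : E3 => -‖v‖ ^ 2 / 2) (-(innerSL ℝ v)) v := by
    have := ((hasStrictFDerivAt_norm_sq v).hasFDerivAt.neg).mul_const (1 / 2 : ℝ)
    have e1 : (fun v : E3 => -‖v‖ ^ 2 / 2) = fun y => (-fun x : E3 => ‖x‖ ^ 2) y * (1 / 2) := by
      funext w; simp; ring
    have e2 : -(innerSL ℝ v) = (1 / 2 : ℝ) • -(2 • (innerSL ℝ v)) := by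
      ext w; simp
    rw [e1, e2]
    exact this
  have := h1.exp.const_mul ((2 * π) ^ (-(3 : ℝ) / 2))
  refine this.congr_fderiv ?_
  ext w; simp [mul_assoc]

lemma PG.differentiable {f : E3 → ℝ} (hf : PG f) : Differentiable ℝ f := by
  induction hf with
  | base => exact fun v => (gauss_hasFDerivAt v).differentiableAt
  | coord i f _ ih =>
    exact (by fun_prop : Differentiable ℝ fun v : E3 => v i).mul ih
  | add f g _ _ ihf ihg => exact ihf.add ihg
  | smul c f _ ih => exact ih.const_mul c

lemma PG.pd {f : E3 → ℝ} (hf : PG f) (i : Fin 3) : PG (pd i f) := by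
  induction hf with
  | base =>
    have : _root_.pd i gauss = fun v => (-1) * (v i * gauss v) := by
      funext v
      unfold _root_.pd
      rw [(gauss_hasFDerivAt v).fderiv]
      simp [mul_comm, EuclideanSpace.inner_single_right]
    rw [this]
    exact .smul _ _ (.coord _ _ .base)
  | coord j f hf ih =>
    have : _root_.pd i (fun v => v j * f v) =
        fun v => v j * _root_.pd i f v + (if j = i then 1 else 0) * f v := by
      funext v
      unfold _root_.pd
      have h1 : HasFDerivAt (fun v : E3 => v j) (EuclideanSpace.proj j : E3 →L[ℝ] ℝ) v :=
        (EuclideanSpace.proj j : E3 →L[ℝ] ℝ).hasFDerivAt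
      have h2 : HasFDerivAt (fun v => v j * f v) _ v :=
        h1.mul (hf.differentiable v).hasFDerivAt
      rw [h2.fderiv]
      simp [mul_comm, Pi.single_apply]
    rw [this]
    exact .add _ _ (.coord _ _ ih) (.smul _ _ hf)
  | add f g hf hg ihf ihg =>
    rw [pd_add hf.differentiable hg.differentiable i]
    exact .add _ _ ihf ihg
  | smul c f hf ih =>
    have : _root_.pd i (fun v => c * f v) = fun v => c * _root_.pd i f v := by
      funext v
      unfold _root_.pd
      rw [((hf.differentiable v).hasFDerivAt.const_mul c).fderiv]
      simp
    rw [this]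
    exact .smul _ _ ih

lemma gauss_nonneg (v : E3) : 0 ≤ gauss v := by unfold gauss; positivity

lemma gauss_bound (n : ℕ) : ∃ C : ℝ, ∀ v, |gauss v| ≤ C * jap v ^ (-(2 * n : ℝ)) := by
  refine ⟨(2 * π) ^ (-(3 : ℝ) / 2) * (n.factorial * 2 ^ n * Real.exp (1 / 2)), fun v => ?_⟩
  rw [abs_of_nonneg (gauss_nonneg v)]
  unfold gauss
  rw [mul_assoc]
  gcongr
  have hj := jap_sq v
  have hp := jap_pos v
  have h1 := Real.pow_div_factorial_le_exp (jap v ^ 2 / 2) (by positivity) n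
  have e : jap v ^ (-(2 * n : ℝ)) = ((jap v ^ 2) ^ n)⁻¹ := by
    rw [Real.rpow_neg hp.le, ← pow_mul, ← Real.rpow_natCast]
    push_cast; rfl
  have e2 : Real.exp (-‖v‖ ^ 2 / 2) = Real.exp (1 / 2) * (Real.exp (jap v ^ 2 / 2))⁻¹ := by
    rw [← Real.exp_neg, ← Real.exp_add, hj]; congr 1; ring
  rw [e, e2]
  have h2 : (Real.exp (jap v ^ 2 / 2))⁻¹ ≤ ((jap v ^ 2 / 2) ^ n / n.factorial)⁻¹ := by
    gcongr
  calc _ ≤ Real.exp (1 / 2) * ((jap v ^ 2 / 2) ^ n / n.factorial)⁻¹ := by gcongr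
    _ = _ := by rw [div_pow, inv_div, div_div_eq_mul_div]; field_simp

lemma PG.bound {f : E3 → ℝ} (hf : PG f) (s : ℝ) : ∃ C : ℝ, ∀ v, |f v| ≤ C * jap v ^ s := by
  induction hf generalizing s with
  | base =>
    obtain ⟨n, hn⟩ := exists_nat_ge (-s)
    obtain ⟨C, hC⟩ := gauss_bound n
    refine ⟨C, fun v => (hC v).trans ?_⟩
    have := bound_nonneg hC
    gcongr
    · exact one_le_jap v
    · have : (0 : ℝ) ≤ n := n.cast_nonneg
      linarith
  | coord i f _ ih =>
    obtain ⟨C, hC⟩ := ih (s - 1)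
    refine ⟨C, fun v => ?_⟩
    have hp := jap_pos v
    rw [abs_mul]
    calc |v i| * |f v| ≤ jap v * (C * jap v ^ (s - 1)) := by
          gcongr
          · exact (PiLp.norm_apply_le v i).trans (norm_le_jap v)
          · exact hC v
      _ = _ := by rw [Real.rpow_sub_one hp.ne']; field_simp
  | add f g _ _ ihf ihg =>
    obtain ⟨C, hC⟩ := ihf s
    obtain ⟨D, hD⟩ := ihg s
    refine ⟨C + D, fun v => (abs_add_le _ _).trans ?_⟩
    rw [add_mul]
    exact add_le_add (hC v) (hD v)
  | smul c f _ ih =>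
    obtain ⟨C, hC⟩ := ih s
    refine ⟨|c| * C, fun v => ?_⟩
    rw [abs_mul, mul_assoc]
    gcongr
    exact hC v

lemma sym_gauss (s : ℝ) : SymCl s gauss :=
  sym_of_coind (fun _ f => PG f) (fun _ _ h => h.differentiable) (fun _ _ h i => h.pd i)
    (fun s _ h => h.bound s) PG.base

lemma continuous_gauss : Continuous gauss := (sym_gauss 0).1.continuous

lemma gauss_integrable (r : ℝ) : Integrable (fun w => jap w ^ r * |gauss w|) := by
  obtain ⟨C, hC⟩ := PG.base.bound (-4 - r)
  have h := integrable_rpow_neg_one_add_norm_sq (E := E3) (μ := volume) (r := 4)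
    (by simp; norm_num)
  refine (h.const_mul C).mono'
    ((continuous_jap_rpow r).mul continuous_gauss.abs).aestronglyMeasurable
    (Eventually.of_forall fun w => ?_)
  have hp := jap_pos w
  rw [Real.norm_of_nonneg (by positivity)]
  have e : (1 + ‖w‖ ^ 2) ^ (-(4 : ℝ) / 2) = jap w ^ (-4 : ℝ) := by
    rw [← jap_sq, ← Real.rpow_natCast, ← Real.rpow_mul hp.le]; norm_num
  rw [e]
  calc _ ≤ jap w ^ r * (C * jap w ^ (-4 - r)) := by gcongr; exact hC w
    _ = C * (jap w ^ r * jap w ^ (-4 - r)) := by ring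
    _ = _ := by rw [← Real.rpow_add hp]; congr 2; ring

/-! ### Homogeneous functions -/

def Hom (s : ℝ) (b : E3 → ℝ) : Prop :=
  ContDiffOn ℝ (⊤ : ℕ∞) b {0}ᶜ ∧ ∀ t : ℝ, 0 < t → ∀ z : E3, z ≠ 0 → b (t • z) = t ^ s * b z

lemma Hom.pd {s : ℝ} {b : E3 → ℝ} (hb : Hom s b) (i : Fin 3) : Hom (s - 1) (pd i b) := by
  have hopen : IsOpen ({0}ᶜ : Set E3) := isOpen_compl_singleton
  have hd : ∀ z : E3, z ≠ 0 → DifferentiableAt ℝ b z := fun z hz =>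
    (hb.1.contDiffAt (hopen.mem_nhds hz)).differentiableAt (by simp)
  refine ⟨?_, ?_⟩
  · unfold _root_.pd
    exact (hb.1.fderiv_of_isOpen hopen (m := (⊤ : ℕ∞)) (by simp)).clm_apply contDiffOn_const
  · intro t ht z hz
    have htz : t • z ≠ 0 := smul_ne_zero ht.ne' hz
    have h1 : HasFDerivAt (fun x => b (t • x)) (t • fderiv ℝ b (t • z)) z := by
      have := (hd _ htz).hasFDerivAt.comp z ((hasFDerivAt_id z).const_smul t)
      refine HasFDerivAt.congr_fderiv this ?_
      ext w; simp
    have h2 : HasFDerivAt (fun x => t ^ s * b x) (t ^ s • fderiv ℝ b z) z :=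
      (hd z hz).hasFDerivAt.const_mul _
    have h3 : (fun x => b (t • x)) =ᶠ[nhds z] fun x => t ^ s * b x :=
      (hopen.mem_nhds hz : _ ∈ nhds z) |> fun h => Filter.mem_of_superset h
        fun x hx => hb.2 t ht x hx
    have h4 := h1.unique (h2.congr_of_eventuallyEq h3)
    have h5 := congrArg (fun T : E3 →L[ℝ] ℝ => T (EuclideanSpace.single i 1)) h4
    simp only [ContinuousLinearMap.smul_apply, smul_eq_mul] at h5
    unfold _root_.pd
    rw [Real.rpow_sub_one ht.ne']
    field_simp
    linarith

lemma Hom.bound {s : ℝ} {b : E3 → ℝ} (hb : Hom s b) :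
    ∃ C : ℝ, 0 ≤ C ∧ ∀ z, z ≠ 0 → |b z| ≤ C * ‖z‖ ^ s := by
  have hc : ContinuousOn b (Metric.sphere 0 1) := hb.1.continuousOn.mono (by
    intro z hz h
    simp at h
    simp [h] at hz)
  obtain ⟨C, hC⟩ := (isCompact_sphere (0 : E3) 1).exists_bound_of_continuousOn hc
  refine ⟨|C|, abs_nonneg _, fun z hz => ?_⟩
  have hn : 0 < ‖z‖ := norm_pos_iff.2 hz
  have h1 := hb.2 ‖z‖ hn (‖z‖⁻¹ • z) (smul_ne_zero (inv_ne_zero hn.ne') hz)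
  rw [smul_smul, mul_inv_cancel₀ hn.ne', one_smul] at h1
  rw [h1, abs_mul, abs_of_pos (Real.rpow_pos_of_pos hn s), mul_comm]
  refine mul_le_mul_of_nonneg_right ?_ (Real.rpow_nonneg hn.le _)
  refine (hC _ ?_).trans (le_abs_self C)
  simp [norm_smul, hn.ne']

lemma Hom.pdl_bound {s : ℝ} {b : E3 → ℝ} (hb : Hom s b) (l : List (Fin 3)) :
    ∃ C : ℝ, 0 ≤ C ∧ ∀ z, z ≠ 0 → |pdl l b z| ≤ C * ‖z‖ ^ (s - (l.length : ℝ)) := by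
  induction l generalizing s b with
  | nil => simpa [pdl] using hb.bound
  | cons i l ih =>
    obtain ⟨C, h0, hC⟩ := ih (hb.pd i)
    refine ⟨C, h0, fun z hz => ?_⟩
    have e : s - ((i :: l).length : ℝ) = s - 1 - (l.length : ℝ) := by
      push_cast [List.length_cons]; ring
    rw [e]
    exact hC z hz

lemma pdl_congr {f g : E3 → ℝ} {z : E3} (h : f =ᶠ[nhds z] g) (l : List (Fin 3)) :
    pdl l f =ᶠ[nhds z] pdl l g := by
  induction l generalizing f g with
  | nil => exact h
  | cons i l ih =>
    refine ih ?_
    filter_upwards [h.fderiv (𝕜 := ℝ)] with x hx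
    unfold pd
    rw [hx]

lemma norm_rpow_le (r : ℝ) (z : E3) (hz : 1 ≤ ‖z‖) : ‖z‖ ^ r ≤ 2 ^ |r| * jap z ^ r := by
  have hj := jap_pos z
  have hn : 0 < ‖z‖ := by linarith
  rcases le_total 0 r with hr | hr
  · have h1 : ‖z‖ ^ r ≤ jap z ^ r := Real.rpow_le_rpow hn.le (norm_le_jap z) hr
    have h2 : (1 : ℝ) ≤ 2 ^ |r| := Real.one_le_rpow (by norm_num) (abs_nonneg _)
    have h3 : 0 < jap z ^ r := Real.rpow_pos_of_pos hj r
    nlinarith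
  · rw [abs_of_nonpos hr, Real.rpow_neg (by norm_num), ← Real.inv_rpow (by norm_num),
      ← Real.mul_rpow (by norm_num) hj.le]
    refine Real.rpow_le_rpow_of_nonpos (by positivity) ?_ hr
    have := jap_le z
    linarith

lemma sym_of_hom {s : ℝ} {f b : E3 → ℝ} (hf : ContDiff ℝ (⊤ : ℕ∞) f) (hb : Hom s b)
    (hfb : ∀ z, 2 < ‖z‖ → f z = b z) : SymCl s f := by
  refine ⟨hf, fun l => ?_⟩
  obtain ⟨C, hC0, hC⟩ := hb.pdl_bound l
  set r := s - (l.length : ℝ)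
  have hcont : Continuous (fun z => pdl l f z * jap z ^ (-r)) :=
    (pdl_contDiff hf l).continuous.mul (continuous_jap_rpow _)
  obtain ⟨M, hM⟩ := (isCompact_closedBall (0 : E3) 2).exists_bound_of_continuousOn
    hcont.continuousOn
  refine ⟨|M| + C * 2 ^ |r|, fun z => ?_⟩
  have hp := jap_pos z
  have hpr : 0 < jap z ^ r := Real.rpow_pos_of_pos hp r
  rcases le_or_gt ‖z‖ 2 with h | h
  · have h1 := (hM z (by simpa using h)).trans (le_abs_self M)
    rw [norm_mul, Real.norm_eq_abs, Real.norm_of_nonneg (by positivity), Real.rpow_neg hp.le,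
      ← div_eq_mul_inv, div_le_iff₀ hpr] at h1
    refine h1.trans ?_
    gcongr
    have : 0 ≤ C * 2 ^ |r| := by positivity
    linarith
  · have hev : f =ᶠ[nhds z] b := by
      have : IsOpen {z : E3 | 2 < ‖z‖} := isOpen_lt continuous_const continuous_norm
      filter_upwards [this.mem_nhds h] with x hx using hfb x hx
    rw [(pdl_congr hev l).eq_of_nhds]
    have hz : z ≠ 0 := by
      rintro rfl
      simp at h
      linarith
    refine (hC z hz).trans ?_
    calc C * ‖z‖ ^ r ≤ C * (2 ^ |r| * jap z ^ r) := by
          gcongr; exact norm_rpow_le r z (by linarith)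
      _ ≤ _ := by
          rw [add_mul, mul_assoc]
          have : 0 ≤ |M| * jap z ^ r := by positivity
          linarith

/-! ### The matrix `a` -/

lemma hom_amat (γ : ℝ) (i j : Fin 3) : Hom (γ + 2) (fun z => amat γ z i j) := by
  refine ⟨?_, ?_⟩
  · intro z hz
    have hz : z ≠ 0 := hz
    have hn : ‖z‖ ≠ 0 := norm_ne_zero_iff.2 hz
    have h1 : ContDiffAt ℝ (⊤ : ℕ∞) (fun z : E3 => ‖z‖) z := contDiffAt_norm ℝ hz
    have hc : ∀ k : Fin 3, ContDiffAt ℝ (⊤ : ℕ∞) (fun z : E3 => z k) z := fun k =>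
      (EuclideanSpace.proj k : E3 →L[ℝ] ℝ).contDiff.contDiffAt
    refine ContDiffAt.contDiffWithinAt ?_
    unfold amat
    exact (h1.rpow_const_of_ne hn).mul
      (contDiffAt_const.sub (((hc i).mul (hc j)).div (h1.pow 2) (pow_ne_zero 2 hn)))
  · intro t ht z hz
    have hn : ‖z‖ ≠ 0 := norm_ne_zero_iff.2 hz
    show amat γ (t • z) i j = t ^ (γ + 2) * amat γ z i j
    unfold amat
    rw [norm_smul, Real.norm_of_nonneg ht.le, Real.mul_rpow ht.le (norm_nonneg _), mul_assoc]
    congr 3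
    simp
    field_simp

lemma continuous_amat {γ : ℝ} (hγ : 0 ≤ γ) (i j : Fin 3) : Continuous (fun z => amat γ z i j) := by
  have hH := hom_amat γ i j
  rw [continuous_iff_continuousAt]
  intro z
  by_cases hz : z = 0
  · subst hz
    obtain ⟨C, hC0, hC⟩ := hH.bound
    have h0 : amat γ 0 i j = 0 := by
      unfold amat
      rw [norm_zero, Real.zero_rpow (by linarith), zero_mul]
    show Tendsto (fun z => amat γ z i j) (nhds 0) (nhds (amat γ 0 i j))
    rw [h0]
    refine squeeze_zero_norm (a := fun z : E3 => C * ‖z‖ ^ (γ + 2)) (fun z => ?_) ?_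
    · by_cases hz : z = 0
      · subst hz
        rw [h0, norm_zero]; positivity
      · exact hC z hz
    · have : Continuous (fun z : E3 => C * ‖z‖ ^ (γ + 2)) :=
        (continuous_norm.rpow_const (fun _ => Or.inr (by linarith))).const_mul C |> fun h => h
      have h2 := this.tendsto 0
      simpa [Real.zero_rpow (by linarith : γ + 2 ≠ 0)] using h2
  · exact hH.1.continuousOn.continuousAt (isOpen_compl_singleton.mem_nhds hz)

/-- A smooth cutoff. -/
def bump : ContDiffBump (0 : E3) := ⟨1, 2, one_pos, by norm_num⟩

lemma sym_abar {γ : ℝ} (hγ : 0 ≤ γ) (i j : Fin 3) : SymCl (γ + 2) (fun v => abar γ v i j) := by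
  have hH := hom_amat γ i j
  have hac := continuous_amat hγ i j
  set b : E3 → ℝ := fun z => amat γ z i j with hbdef
  have hbumpc : Continuous (bump : E3 → ℝ) := bump.continuous
  set a0 : E3 → ℝ := fun z => bump z * b z with ha0
  set a1 : E3 → ℝ := fun z => (1 - bump z) * b z with ha1
  have ha0c : Continuous a0 := hbumpc.mul hac
  have ha0s : HasCompactSupport a0 := bump.hasCompactSupport.mul_right
  have ha1d : ContDiff ℝ (⊤ : ℕ∞) a1 := by
    rw [contDiff_iff_contDiffAt]
    intro z
    by_cases hz : z = 0
    · subst hz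
      have : a1 =ᶠ[nhds 0] fun _ => 0 := by
        filter_upwards [bump.eventuallyEq_one] with x hx
        simp [ha1, hx]
      exact contDiffAt_const.congr_of_eventuallyEq this
    · exact (contDiffAt_const.sub bump.contDiffAt).mul
        (hH.1.contDiffAt (isOpen_compl_singleton.mem_nhds hz))
  have hS1 : SymCl (γ + 2) a1 := by
    refine sym_of_hom ha1d hH fun z hz => ?_
    have : bump z = 0 := bump.zero_of_le_dist (by simpa [bump] using hz.le)
    simp [ha1, this]
  have hint0 : ∀ r : ℝ, Integrable (fun w => jap w ^ r * |a0 w|) := fun r =>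
    ((continuous_jap_rpow r).mul ha0c.abs).integrable_of_hasCompactSupport
      (ha0s.norm.mul_left)
  have hc1 := sym_cv hS1 continuous_gauss.aestronglyMeasurable gauss_integrable
  have hc0 := sym_cv (sym_gauss (γ + 2)) ha0c.aestronglyMeasurable hint0
  have : (fun v => abar γ v i j) = fun v => cv a1 gauss v + cv gauss a0 v := by
    funext v
    obtain ⟨C, hC⟩ := hS1.bound
    obtain ⟨D, hD⟩ := (sym_gauss (γ + 2)).bound
    have i1 := cv_integrable ha1d.continuous hC continuous_gauss.aestronglyMeasurable
      gauss_integrable v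
    have i2 := cv_integrable continuous_gauss hD ha0c.aestronglyMeasurable hint0 v
    have i3 : Integrable (fun w => a0 (v - w) * gauss w) := by
      have := i2.comp_sub_left v
      simpa [mul_comm] using this
    have e : cv gauss a0 v = ∫ w, a0 (v - w) * gauss w := by
      unfold cv
      rw [← integral_sub_left_eq_self (fun w => gauss (v - w) * a0 w) volume v]
      simp [mul_comm]
    rw [e]
    unfold abar cv
    rw [← integral_add i1 i3]
    refine integral_congr_ae (Eventually.of_forall fun w => ?_)
    simp only [ha0, ha1, hbdef]
    ring
  rw [this]
  exact hc1.add hc0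

lemma pdl_append (l l' : List (Fin 3)) (f : E3 → ℝ) : pdl (l ++ l') f = pdl l' (pdl l f) := by
  simp [pdl]

lemma pdl_replicate (n : ℕ) (i : Fin 3) (f : E3 → ℝ) :
    pdl (List.replicate n i) f = (pd i)^[n] f := by
  induction n generalizing f with
  | zero => rfl
  | succ n ih => exact ih (pd i f)

/-- `ā` is smooth and for every multi-index `β ∈ ℕ³` there is `C_β > 0` with
`|∂^β ā_{ij}(v)| ≤ C_β ⟨v⟩^{γ+2-|β|}`. -/
theorem stmt7 (γ : ℝ) (hγ0 : 0 ≤ γ) (hγ1 : γ ≤ 1) :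
    (∀ i j, ContDiff ℝ (⊤ : ℕ∞) (fun v => abar γ v i j)) ∧
    ∀ β : Fin 3 → ℕ, ∃ C > (0 : ℝ), ∀ (v : E3) (i j : Fin 3),
      |multiDeriv β (fun v => abar γ v i j) v| ≤
        C * jap v ^ (γ + 2 - ((β 0 + β 1 + β 2 : ℕ) : ℝ)) := by
  refine ⟨fun i j => (sym_abar hγ0 i j).1, fun β => ?_⟩
  set l : List (Fin 3) :=
    List.replicate (β 2) 2 ++ List.replicate (β 1) 1 ++ List.replicate (β 0) 0 with hl
  choose C hC using fun i j => (sym_abar hγ0 i j).2 l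
  refine ⟨1 + ∑ i, ∑ j, |C i j|, by positivity, fun v i j => ?_⟩
  have h := hC i j v
  have e1 : pdl l (fun v => abar γ v i j) = multiDeriv β (fun v => abar γ v i j) := by
    rw [hl, pdl_append, pdl_append, pdl_replicate, pdl_replicate, pdl_replicate]
    rfl
  have e2 : l.length = β 0 + β 1 + β 2 := by
    simp [hl]; ring
  rw [e1, e2] at h
  refine h.trans ?_
  have hp := jap_pos v
  gcongr
  have h1 : |C i j| ≤ ∑ j, |C i j| :=
    Finset.single_le_sum (f := fun j => |C i j|) (fun _ _ => abs_nonneg _) (Finset.mem_univ j)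
  have h2 : ∑ j, |C i j| ≤ ∑ i, ∑ j, |C i j| :=
    Finset.single_le_sum (f := fun i => ∑ j, |C i j|)
      (fun _ _ => Finset.sum_nonneg fun _ _ => abs_nonneg _) (Finset.mem_univ i)
  linarith [le_abs_self (C i j)]
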